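/- arXiv:2411.01370 — 2 statements merged into one kernel-verified Lean document; each statement's English description precedes it below -/
import Mathlib

section
/- (Nonnegativity of the lower bound VMS_R^LB.) Assume f_s ≥ 0 componentwise for every stage s and λ_s ∈ [0,1] for s = 2,…,T, and p_n ≥ 0 for every node n. For any ŷ : 𝒯 → ℝ^J and û : 𝒯∖{r} → ℝ, with b_n = B_{τ(n)} ŷ_n, b̄_n = max_{l∈𝒯_{τ(n)}} b_l, and the constructed quantities x^MS, η^MS, x^TS, η^TS, one has ∑_{n≠r} p_n (1−λ_{τ(n)}) f_{τ(n)} · ( max_{m∈𝒫(n)} ⌈b̄_m⌉ − max_{m∈𝒫(n)} ⌈b_m⌉ ) + ∑_{n∉ℒ} p_n λ_{τ(n)+1} ( η^TS_n − η^MS_n ) ≥ 0; in fact both sums are termwise nonnegative. -/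
open Finset

/-- A scenario tree with `T` stages: a finite nonempty set of nodes with a root,
a parent map fixing the root, a stage map decreasing by one along the parent map,
such that every node reaches the root by iterating the parent map, and every
non-leaf node has a child. -/
structure STree (T : ℕ) : Type 1 where
  Node : Type
  fin : Fintype Node
  deceq : DecidableEq Node
  root : Node
  parent : Node → Node
  stage : Node → ℕ
  hT : 1 ≤ T
  parent_root : parent root = root
  stage_root : stage root = 1
  stage_ge : ∀ n, 1 ≤ stage n
  stage_le : ∀ n, stage n ≤ T
  stage_parent : ∀ n, n ≠ root → stage (parent n) = stage n - 1
  reaches_root : ∀ n, ∃ k, parent^[k] n = root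
  children_ne : ∀ n, stage n ≠ T → ∃ m, m ≠ root ∧ parent m = n

attribute [instance] STree.fin STree.deceq

namespace STree

variable {T : ℕ} (S : STree T)

/-- The path set `𝒫(n) = {aᵏ(n) : k ≥ 0}` of a node. -/
def path (n : S.Node) : Finset S.Node :=
  (Finset.range T).image fun k => S.parent^[k] n

theorem path_nonempty (n : S.Node) : (S.path n).Nonempty :=
  ⟨n, Finset.mem_image.mpr ⟨0, Finset.mem_range.mpr S.hT, rfl⟩⟩

/-- The children `𝒞(n)` of a node. -/
def children (n : S.Node) : Finset S.Node :=
  Finset.univ.filter fun m => m ≠ S.root ∧ S.parent m = n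

theorem children_nonempty {n : S.Node} (h : S.stage n ≠ T) : (S.children n).Nonempty := by
  obtain ⟨m, h1, h2⟩ := S.children_ne n h
  exact ⟨m, Finset.mem_filter.mpr ⟨Finset.mem_univ m, h1, h2⟩⟩

/-- The set `𝒯ₛ` of stage-`s` nodes. -/
def stageNodes (s : ℕ) : Finset S.Node :=
  Finset.univ.filter fun n => S.stage n = s

theorem stageNodes_self_nonempty (n : S.Node) : (S.stageNodes (S.stage n)).Nonempty :=
  ⟨n, Finset.mem_filter.mpr ⟨Finset.mem_univ n, rfl⟩⟩

end STree

section Constructions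

variable {T M J : ℕ}

/-- `b_n = B_{τ(n)} ŷ_n` (componentwise). -/
noncomputable def bvec (S : STree T) (B : ℕ → Matrix (Fin M) (Fin J) ℝ)
    (yh : S.Node → Fin J → ℝ) (n : S.Node) (i : Fin M) : ℝ :=
  (B (S.stage n)).mulVec (yh n) i

/-- Componentwise maximum of `b` over all nodes of the same stage as `n`
(used for `b̄_n = max_{l ∈ 𝒯_{τ(n)}} b_l`). -/
noncomputable def stageMax (S : STree T) (b : S.Node → Fin M → ℝ) (n : S.Node) (i : Fin M) : ℝ :=
  (S.stageNodes (S.stage n)).sup' (S.stageNodes_self_nonempty n) fun l => b l i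

/-- `max_{m ∈ 𝒫(n)} ⌈b_m⌉` (componentwise). -/
noncomputable def pmc (S : STree T) (b : S.Node → Fin M → ℝ) (n : S.Node) (i : Fin M) : ℤ :=
  (S.path n).sup' (S.path_nonempty n) fun m => ⌈b m i⌉

/-- `max_{m ∈ 𝒫(n)} b_m` (componentwise, no rounding). -/
noncomputable def pm (S : STree T) (b : S.Node → Fin M → ℝ) (n : S.Node) (i : Fin M) : ℝ :=
  (S.path n).sup' (S.path_nonempty n) fun m => b m i

end Constructions

namespace STree

variable {T : ℕ} (S : STree T)

theorem eq_root_of_stage_le_one {n : S.Node} (h : S.stage n ≤ 1) : n = S.root := by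
  by_contra hn
  have h1 := S.stage_parent n hn
  have h2 := S.stage_ge (S.parent n)
  omega

theorem stage_parent_add_one {n : S.Node} (hn : n ≠ S.root) :
    S.stage (S.parent n) + 1 = S.stage n := by
  have h1 := S.stage_parent n hn
  have h2 := S.stage_ge (S.parent n)
  omega

theorem stage_iterate_le (n : S.Node) (k : ℕ) : S.stage (S.parent^[k] n) ≤ S.stage n := by
  induction k with
  | zero => exact le_rfl
  | succ k ih =>
    rw [Function.iterate_succ_apply']
    by_cases h : S.parent^[k] n = S.root
    · rw [h, S.parent_root, ← h]
      exact ih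
    · have := S.stage_parent_add_one h
      omega

theorem iterate_root (k : ℕ) : S.parent^[k] S.root = S.root :=
  Function.iterate_fixed S.parent_root k

theorem iterate_eq_root (k : ℕ) (n : S.Node) (h : S.stage n ≤ k + 1) :
    S.parent^[k] n = S.root := by
  induction k generalizing n with
  | zero => exact S.eq_root_of_stage_le_one h
  | succ k ih =>
    by_cases hn : n = S.root
    · rw [hn, S.iterate_root]
    · rw [Function.iterate_succ_apply]
      have := S.stage_parent_add_one hn
      exact ih _ (by omega)

theorem mem_path {n l : S.Node} : l ∈ S.path n ↔ ∃ k, S.parent^[k] n = l := by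
  simp only [path, mem_image, mem_range]
  refine ⟨fun ⟨k, _, h⟩ => ⟨k, h⟩, fun ⟨k, h⟩ => ?_⟩
  have hT := S.hT
  have hs := S.stage_le n
  by_cases hk : k < T
  · exact ⟨k, hk, h⟩
  · refine ⟨T - 1, by omega, ?_⟩
    rw [← h, S.iterate_eq_root _ n (by omega), S.iterate_eq_root _ n (by omega)]

theorem path_root : S.path S.root = {S.root} := by
  ext l
  simp [mem_path, iterate_root, eq_comm]

theorem path_eq_insert (n : S.Node) : S.path n = insert n (S.path (S.parent n)) := by
  ext l
  simp only [mem_insert, mem_path]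
  constructor
  · rintro ⟨_ | k, h⟩
    · exact Or.inl h.symm
    · exact Or.inr ⟨k, h⟩
  · rintro (h | ⟨k, h⟩)
    · exact ⟨0, h.symm⟩
    · exact ⟨k + 1, h⟩

theorem notMem_path_parent {n : S.Node} (hn : n ≠ S.root) : n ∉ S.path (S.parent n) := by
  rw [mem_path]
  rintro ⟨k, h⟩
  have h1 := S.stage_iterate_le (S.parent n) k
  rw [h] at h1
  have h2 := S.stage_parent_add_one hn
  omega

end STree

section Constructions

variable {T M : ℕ} (S : STree T)

theorem pmc_root (b : S.Node → Fin M → ℝ) (i : Fin M) : pmc S b S.root i = ⌈b S.root i⌉ := by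
  simp [pmc, S.path_root]

theorem pmc_le_pmc_stageMax (b : S.Node → Fin M → ℝ) (n : S.Node) (i : Fin M) :
    pmc S b n i ≤ pmc S (stageMax S b) n i := by
  refine sup'_mono_fun fun m _ => Int.ceil_mono ?_
  exact le_sup' (fun l => b l i) (by simp [STree.stageNodes])

/-- Increments of the path maximum telescope along the path. -/
theorem sum_path_eq_pmc (b : S.Node → Fin M → ℝ) (x : S.Node → Fin M → ℤ)
    (hr : ∀ i, x S.root i = ⌈b S.root i⌉)
    (hx : ∀ n, n ≠ S.root → ∀ i, x n i = pmc S b n i - pmc S b (S.parent n) i)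
    (n : S.Node) (i : Fin M) : ∑ l ∈ S.path n, x l i = pmc S b n i := by
  induction hs : S.stage n generalizing n with
  | zero =>
    have := S.stage_ge n
    omega
  | succ s ih =>
    by_cases hn : n = S.root
    · rw [hn, S.path_root, sum_singleton, pmc_root, hr]
    · have h := S.stage_parent_add_one hn
      rw [S.path_eq_insert, sum_insert (S.notMem_path_parent hn), ih _ (by omega), hx n hn]
      ring

end Constructions

/-- nonnegativity of the lower bound `VMS_R^LB`: both sums in the
lower bound of Theorem 1 are termwise nonnegative, hence so is their total. -/
theorem vms_lower_bound_nonneg {T M J : ℕ} (S : STree T)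
    (p : S.Node → ℝ) (f : ℕ → Fin M → ℝ) (c : ℕ → Fin J → ℝ)
    (B : ℕ → Matrix (Fin M) (Fin J) ℝ) (lam : ℕ → ℝ)
    (hp : ∀ n, 0 ≤ p n)
    (hf : ∀ s, 1 ≤ s → s ≤ T → ∀ i, 0 ≤ f s i)
    (hlam : ∀ s, 2 ≤ s → s ≤ T → 0 ≤ lam s ∧ lam s ≤ 1)
    (yh : S.Node → Fin J → ℝ) (uh : S.Node → ℝ)
    (xMS xTS : S.Node → Fin M → ℤ) (etaMS etaTS : S.Node → ℝ)
    (hxMSr : ∀ i, xMS S.root i = ⌈bvec S B yh S.root i⌉)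
    (hxMSn : ∀ n, n ≠ S.root → ∀ i,
      xMS n i = pmc S (bvec S B yh) n i - pmc S (bvec S B yh) (S.parent n) i)
    (hxTSr : ∀ i, xTS S.root i = ⌈stageMax S (bvec S B yh) S.root i⌉)
    (hxTSn : ∀ n, n ≠ S.root → ∀ i,
      xTS n i = pmc S (stageMax S (bvec S B yh)) n i
              - pmc S (stageMax S (bvec S B yh)) (S.parent n) i)
    (hetaMS : ∀ n (hn : S.stage n ≠ T), etaMS n =
      (S.children n).sup' (S.children_nonempty hn) fun m =>
        (∑ i, f (S.stage m) i * ∑ l ∈ S.path m, (xMS l i : ℝ))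
          + (∑ j, c (S.stage m) j * yh m j) - uh m)
    (hetaTS : ∀ n (hn : S.stage n ≠ T), etaTS n =
      (S.children n).sup' (S.children_nonempty hn) fun m =>
        (∑ i, f (S.stage m) i * ∑ l ∈ S.path m, (xTS l i : ℝ))
          + (∑ j, c (S.stage m) j * yh m j) - uh m) :
    (∀ n, n ≠ S.root → 0 ≤ p n * ((1 - lam (S.stage n)) *
        ∑ i, f (S.stage n) i *
          ((pmc S (stageMax S (bvec S B yh)) n i : ℝ) - (pmc S (bvec S B yh) n i : ℝ)))) ∧
    (∀ n, S.stage n ≠ T → 0 ≤ p n * lam (S.stage n + 1) * (etaTS n - etaMS n)) ∧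
    0 ≤ (∑ n ∈ Finset.univ.filter (fun n => n ≠ S.root),
          p n * ((1 - lam (S.stage n)) *
            ∑ i, f (S.stage n) i *
              ((pmc S (stageMax S (bvec S B yh)) n i : ℝ) - (pmc S (bvec S B yh) n i : ℝ))))
        + ∑ n ∈ Finset.univ.filter (fun n => S.stage n ≠ T),
            p n * lam (S.stage n + 1) * (etaTS n - etaMS n) := by
  have hle (n i) : (pmc S (bvec S B yh) n i : ℝ) ≤ (pmc S (stageMax S (bvec S B yh)) n i : ℝ) :=
    Int.cast_le.mpr (pmc_le_pmc_stageMax S _ n i)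
  have hfn (n i) : 0 ≤ f (S.stage n) i := hf _ (S.stage_ge n) (S.stage_le n) i
  have h1 : ∀ n, n ≠ S.root → 0 ≤ p n * ((1 - lam (S.stage n)) *
      ∑ i, f (S.stage n) i *
        ((pmc S (stageMax S (bvec S B yh)) n i : ℝ) - (pmc S (bvec S B yh) n i : ℝ))) := by
    intro n hn
    have hs := S.stage_parent_add_one hn
    have hs' := S.stage_ge (S.parent n)
    have hl := hlam (S.stage n) (by omega) (S.stage_le n)
    exact mul_nonneg (hp n) (mul_nonneg (sub_nonneg.mpr hl.2)
      (sum_nonneg fun i _ => mul_nonneg (hfn n i) (sub_nonneg.mpr (hle n i))))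
  have h2 : ∀ n, S.stage n ≠ T → 0 ≤ p n * lam (S.stage n + 1) * (etaTS n - etaMS n) := by
    intro n hn
    have hs := S.stage_ge n
    have hs' := S.stage_le n
    have hl := hlam (S.stage n + 1) (by omega) (by omega)
    refine mul_nonneg (mul_nonneg (hp n) hl.1) (sub_nonneg.mpr ?_)
    rw [hetaMS n hn, hetaTS n hn]
    refine sup'_mono_fun fun m _ => ?_
    refine sub_le_sub_right (add_le_add_left (sum_le_sum fun i _ =>
      mul_le_mul_of_nonneg_left ?_ (hfn m i)) _) _
    have h := hle m i
    rw [← sum_path_eq_pmc S _ xMS hxMSr hxMSn m i,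
      ← sum_path_eq_pmc S _ xTS hxTSr hxTSn m i] at h
    exact_mod_cast h
  exact ⟨h1, h2, add_nonneg (sum_nonneg fun n hn => h1 n (mem_filter.mp hn).2)
    (sum_nonneg fun n hn => h2 n (mem_filter.mp hn).2)⟩
end

section
/- (Key lower bound in the proof of Theorem 4.) In the concrete capacity model, let D₁ := ∑_{j=1}^N d_{r,j} and h_max := max_{i=1,…,M} h_{1,i}. Then every feasible tuple (x,y,η,u) satisfies F(x,y,η,u) ≥ ⌈D₁ / h_max⌉ · ∑_{s=1}^T min_{i} f_{s,i} + ∑_{s=1}^T ( min_{i,j} c_{s,ij} ) · min_{n∈𝒯_s} ∑_{j=1}^N d_{n,j}; in particular, if the feasible set is nonempty then its infimum z^MS is at least this quantity. -/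
open Finset

namespace STree

variable {T : ℕ} (S : STree T)

theorem stageNodes_nonempty : ∀ s : ℕ, 1 ≤ s → s ≤ T → (S.stageNodes s).Nonempty := by
  intro s
  induction s with
  | zero => intro h _; omega
  | succ k ih =>
    intro _ h2
    by_cases hk : k = 0
    · subst hk
      refine ⟨S.root, ?_⟩
      have hr := S.stage_root
      simp only [stageNodes, Finset.mem_filter, Finset.mem_univ, true_and]
      omega
    · obtain ⟨n, hn⟩ := ih (by omega) (by omega)
      simp only [stageNodes, Finset.mem_filter, Finset.mem_univ, true_and] at hn
      have hnT : S.stage n ≠ T := by omega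
      obtain ⟨m, hm1, hm2⟩ := S.children_ne n hnT
      have h3 := S.stage_parent m hm1
      have h4 := S.stage_ge m
      rw [hm2] at h3
      refine ⟨m, ?_⟩
      simp only [stageNodes, Finset.mem_filter, Finset.mem_univ, true_and]
      omega

end STree

section ConcreteModel

variable {T M N : ℕ}

/-- Stage cost `g_n` of node `n` in the concrete capacity planning model. -/
noncomputable def gcost (S : STree T) (f : ℕ → Fin M → ℝ) (c : ℕ → Fin M → Fin N → ℝ)
    (x : S.Node → Fin M → ℤ) (y : S.Node → Fin M → Fin N → ℝ) (n : S.Node) : ℝ :=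
  (∑ i, f (S.stage n) i * ∑ m ∈ S.path n, (x m i : ℝ)) + ∑ i, ∑ j, c (S.stage n) i j * y n i j

/-- Feasibility for the concrete capacity planning model on the scenario tree. -/
def CFeas (S : STree T) (h f : ℕ → Fin M → ℝ) (c : ℕ → Fin M → Fin N → ℝ)
    (d : S.Node → Fin N → ℝ)
    (x : S.Node → Fin M → ℤ) (y : S.Node → Fin M → Fin N → ℝ) (η u : S.Node → ℝ) : Prop :=
  (∀ n i, 0 ≤ x n i) ∧ (∀ n i j, 0 ≤ y n i j) ∧ (∀ n, n ≠ S.root → 0 ≤ u n) ∧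
  (∀ n j, ∑ i, y n i j = d n j) ∧
  (∀ n i, ∑ j, y n i j ≤ h (S.stage n) i * ∑ m ∈ S.path n, (x m i : ℝ)) ∧
  ∀ n, n ≠ S.root → gcost S f c x y n ≤ u n + η (S.parent n)

/-- The risk-averse objective of the concrete capacity planning model. -/
noncomputable def CF (S : STree T) (p : S.Node → ℝ) (f : ℕ → Fin M → ℝ)
    (c : ℕ → Fin M → Fin N → ℝ) (lam alpha : ℕ → ℝ)
    (x : S.Node → Fin M → ℤ) (y : S.Node → Fin M → Fin N → ℝ) (η u : S.Node → ℝ) : ℝ :=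
  ∑ n, p n *
    ((∑ i, (if n = S.root then f 1 i else (1 - lam (S.stage n)) * f (S.stage n) i)
        * ∑ m ∈ S.path n, (x m i : ℝ))
     + (∑ i, ∑ j, (if n = S.root then c 1 i j
                   else (1 - lam (S.stage n)) * c (S.stage n) i j) * y n i j)
     + (if S.stage n = T then 0 else lam (S.stage n + 1)) * η n
     + (if n = S.root then 0 else lam (S.stage n) / (1 - alpha (S.stage n))) * u n)

/-- The analytic lower bound
`⌈D₁/h_max⌉ · ∑ₛ minᵢ f_{s,i} + ∑ₛ (min_{i,j} c_{s,ij}) · min_{n∈𝒯ₛ} ∑ⱼ d_{n,j}`. -/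
noncomputable def lbound [NeZero M] [NeZero N] (S : STree T) (h f : ℕ → Fin M → ℝ)
    (c : ℕ → Fin M → Fin N → ℝ) (d : S.Node → Fin N → ℝ) : ℝ :=
  (⌈(∑ j, d S.root j) / (Finset.univ.sup' Finset.univ_nonempty (h 1))⌉ : ℝ)
      * (∑ s ∈ Finset.Icc 1 T, Finset.univ.inf' Finset.univ_nonempty (f s))
    + ∑ s ∈ (Finset.Icc 1 T).attach,
        (Finset.univ.inf' Finset.univ_nonempty (fun ij : Fin M × Fin N => c s.1 ij.1 ij.2))
          * ((S.stageNodes s.1).inf'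
              (S.stageNodes_nonempty s.1 (Finset.mem_Icc.mp s.2).1 (Finset.mem_Icc.mp s.2).2)
              (fun n => ∑ j, d n j))

end ConcreteModel

namespace STree

variable {T : ℕ} (S : STree T)

theorem eq_root_of_stage_eq_one {n : S.Node} (hn : S.stage n = 1) : n = S.root := by
  by_contra hne
  have h1 := S.stage_parent n hne
  have h2 := S.stage_ge (S.parent n)
  omega

theorem two_le_stage {n : S.Node} (hn : n ≠ S.root) : 2 ≤ S.stage n := by
  have h1 := S.stage_parent_add_one hn
  have h2 := S.stage_ge (S.parent n)
  omega

theorem iterate_parent_eq_root (k : ℕ) : ∀ n, S.stage n = k + 1 → S.parent^[k] n = S.root := by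
  induction k with
  | zero => exact fun n hn => S.eq_root_of_stage_eq_one hn
  | succ k ih =>
    intro n hn
    have hne : n ≠ S.root := by
      rintro rfl
      have := S.stage_root
      omega
    have := S.stage_parent_add_one hne
    exact ih _ (by omega)

theorem root_mem_path (n : S.Node) : S.root ∈ S.path n := by
  have h1 := S.stage_ge n
  have h2 := S.stage_le n
  exact Finset.mem_image.mpr ⟨S.stage n - 1, Finset.mem_range.mpr (by omega),
    S.iterate_parent_eq_root _ n (by omega)⟩

theorem sum_stageNodes (w : S.Node → ℝ) :
    ∑ s ∈ Finset.Icc 1 T, ∑ n ∈ S.stageNodes s, w n = ∑ n, w n :=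
  Finset.sum_fiberwise_of_maps_to
    (fun n _ => Finset.mem_Icc.mpr ⟨S.stage_ge n, S.stage_le n⟩) w

theorem sum_children (w : S.Node → ℝ) :
    ∑ n, ∑ m ∈ S.children n, w m = ∑ m, if m = S.root then 0 else w m := by
  have h1 : ∀ n, S.children n =
      (Finset.univ.filter fun m => m ≠ S.root).filter fun m => S.parent m = n := fun n => by
    rw [Finset.filter_filter]
    rfl
  simp only [h1]
  rw [Finset.sum_fiberwise, Finset.sum_filter]
  exact Finset.sum_congr rfl fun m _ => by split_ifs <;> simp_all

/-- The value-at-risk terms, weighted at the parents, can be redistributed over the children. -/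
theorem sum_eta_eq_sum_parent {p : S.Node → ℝ}
    (hpc : ∀ n, S.stage n ≠ T → ∑ m ∈ S.children n, p m = p n) (lam : ℕ → ℝ) (η : S.Node → ℝ) :
    ∑ n, p n * ((if S.stage n = T then 0 else lam (S.stage n + 1)) * η n) =
      ∑ m, if m = S.root then 0 else p m * (lam (S.stage m) * η (S.parent m)) := by
  rw [← S.sum_children]
  refine Finset.sum_congr rfl fun n _ => ?_
  have hch : ∀ m ∈ S.children n, S.parent m = n ∧ S.stage m = S.stage n + 1 := fun m hm => by
    obtain ⟨-, hm1, hm2⟩ := Finset.mem_filter.mp hm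
    exact ⟨hm2, by rw [← S.stage_parent_add_one hm1, hm2]⟩
  split_ifs with hn
  · rw [zero_mul, mul_zero]
    refine (Finset.sum_eq_zero fun m hm => ?_).symm
    have h1 := (hch m hm).2
    have h2 := S.stage_le m
    omega
  · rw [← hpc n hn, Finset.sum_mul]
    exact Finset.sum_congr rfl fun m hm => by rw [(hch m hm).1, (hch m hm).2]

end STree

section ConcreteModel

variable {T M N : ℕ}

/-- The risk-averse objective dominates the expected total cost. -/
theorem sum_gcost_le_CF (S : STree T) {p : S.Node → ℝ} {h f : ℕ → Fin M → ℝ}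
    {c : ℕ → Fin M → Fin N → ℝ} {d : S.Node → Fin N → ℝ} {lam alpha : ℕ → ℝ}
    (hp : ∀ n, 0 ≤ p n)
    (hpc : ∀ n, S.stage n ≠ T → ∑ m ∈ S.children n, p m = p n)
    (hlam : ∀ s, 2 ≤ s → s ≤ T → 0 ≤ lam s ∧ lam s ≤ 1)
    (halpha : ∀ s, 2 ≤ s → s ≤ T → 0 ≤ alpha s ∧ alpha s < 1)
    {x : S.Node → Fin M → ℤ} {y : S.Node → Fin M → Fin N → ℝ} {η u : S.Node → ℝ}
    (hF : CFeas S h f c d x y η u) :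
    ∑ n, p n * gcost S f c x y n ≤ CF S p f c lam alpha x y η u := by
  obtain ⟨-, -, hu, -, -, hg⟩ := hF
  have hη := S.sum_eta_eq_sum_parent hpc lam η
  unfold CF
  simp only [mul_add (p _), Finset.sum_add_distrib]
  rw [hη]
  simp only [← Finset.sum_add_distrib]
  refine Finset.sum_le_sum fun n _ => ?_
  by_cases hn : n = S.root
  · subst hn
    simp only [if_true, gcost, S.stage_root]
    linarith
  · simp only [if_neg hn, mul_assoc, ← Finset.mul_sum]
    have h2 := S.two_le_stage hn
    obtain ⟨hl0, hl1⟩ := hlam _ h2 (S.stage_le n)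
    obtain ⟨ha0, ha1⟩ := halpha _ h2 (S.stage_le n)
    have hlu : lam (S.stage n) * u n ≤ lam (S.stage n) / (1 - alpha (S.stage n)) * u n := by
      refine mul_le_mul_of_nonneg_right ?_ (hu n hn)
      rw [le_div_iff₀ (by linarith)]
      nlinarith
    have hlg := mul_le_mul_of_nonneg_left (hg n hn) hl0
    have hgd : gcost S f c x y n = (∑ i, f (S.stage n) i * ∑ m ∈ S.path n, (x m i : ℝ))
      + ∑ i, ∑ j, c (S.stage n) i j * y n i j := rfl
    rw [hgd] at hlg ⊢
    rw [← mul_add, ← mul_add, ← mul_add]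
    exact mul_le_mul_of_nonneg_left (by linarith) (hp n)

/-- Serving the root demand requires at least `⌈D₁ / h_max⌉` units of initial capacity. -/
theorem ceil_le_sum_root [NeZero M] (S : STree T) {h f : ℕ → Fin M → ℝ}
    {c : ℕ → Fin M → Fin N → ℝ} {d : S.Node → Fin N → ℝ} (hh : ∀ i, 0 < h 1 i)
    {x : S.Node → Fin M → ℤ} {y : S.Node → Fin M → Fin N → ℝ} {η u : S.Node → ℝ}
    (hF : CFeas S h f c d x y η u) :
    ⌈(∑ j, d S.root j) / (Finset.univ.sup' Finset.univ_nonempty (h 1))⌉ ≤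
      ∑ i, x S.root i := by
  obtain ⟨hx, -, -, hyd, hcap, -⟩ := hF
  have hle : ∀ i, h 1 i ≤ Finset.univ.sup' Finset.univ_nonempty (h 1) :=
    fun i => Finset.le_sup' (h 1) (Finset.mem_univ i)
  rw [Int.ceil_le, div_le_iff₀ ((hh 0).trans_le (hle 0)), Int.cast_sum, Finset.sum_mul]
  simp only [← hyd]
  rw [Finset.sum_comm]
  refine Finset.sum_le_sum fun i _ => (hcap S.root i).trans ?_
  rw [S.path_root, Finset.sum_singleton, S.stage_root, mul_comm]
  exact mul_le_mul_of_nonneg_left (hle i) (Int.cast_nonneg (hx _ _))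

/-- The stage cost is bounded below by the cheapest maintenance of the initial capacity plus the
cheapest allocation of the demand. -/
theorem inf_mul_le_gcost [NeZero M] [NeZero N] (S : STree T) {h f : ℕ → Fin M → ℝ}
    {c : ℕ → Fin M → Fin N → ℝ} {d : S.Node → Fin N → ℝ}
    (hf : ∀ s, 1 ≤ s → s ≤ T → ∀ i, 0 ≤ f s i)
    {x : S.Node → Fin M → ℤ} {y : S.Node → Fin M → Fin N → ℝ} {η u : S.Node → ℝ}
    (hF : CFeas S h f c d x y η u) (n : S.Node) :
    (Finset.univ.inf' Finset.univ_nonempty (f (S.stage n))) * ∑ i, (x S.root i : ℝ)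
      + (Finset.univ.inf' Finset.univ_nonempty
          (fun ij : Fin M × Fin N => c (S.stage n) ij.1 ij.2)) * ∑ j, d n j
      ≤ gcost S f c x y n := by
  obtain ⟨hx, hy, -, hyd, -, -⟩ := hF
  have hx' : ∀ m i, (0 : ℝ) ≤ x m i := fun m i => Int.cast_nonneg (hx m i)
  refine add_le_add ?_ ?_
  · rw [Finset.mul_sum]
    refine Finset.sum_le_sum fun i _ => mul_le_mul (Finset.inf'_le _ (Finset.mem_univ i)) ?_
      (hx' _ _) (hf _ (S.stage_ge n) (S.stage_le n) i)
    exact Finset.single_le_sum (f := fun m => (x m i : ℝ)) (fun m _ => hx' m i) (S.root_mem_path n)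
  · simp only [← hyd]
    rw [Finset.sum_comm, Finset.mul_sum]
    refine Finset.sum_le_sum fun i _ => ?_
    rw [Finset.mul_sum]
    exact Finset.sum_le_sum fun j _ => mul_le_mul_of_nonneg_right
      (Finset.inf'_le (fun ij : Fin M × Fin N => c (S.stage n) ij.1 ij.2)
        (Finset.mem_univ (i, j))) (hy n i j)

/-- The expected total cost of a feasible tuple is at least the analytic lower bound. -/
theorem lbound_le_sum_gcost [NeZero M] [NeZero N] (S : STree T) {p : S.Node → ℝ}
    {h f : ℕ → Fin M → ℝ} {c : ℕ → Fin M → Fin N → ℝ} {d : S.Node → Fin N → ℝ}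
    (hp : ∀ n, 0 ≤ p n)
    (hp1 : ∀ s, 1 ≤ s → s ≤ T → ∑ n ∈ S.stageNodes s, p n = 1)
    (hh : ∀ i, 0 < h 1 i)
    (hf : ∀ s, 1 ≤ s → s ≤ T → ∀ i, 0 ≤ f s i)
    (hc : ∀ s, 1 ≤ s → s ≤ T → ∀ i j, 0 ≤ c s i j)
    {x : S.Node → Fin M → ℤ} {y : S.Node → Fin M → Fin N → ℝ} {η u : S.Node → ℝ}
    (hF : CFeas S h f c d x y η u) :
    lbound S h f c d ≤ ∑ n, p n * gcost S f c x y n := by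
  have hceil : (⌈(∑ j, d S.root j) / (Finset.univ.sup' Finset.univ_nonempty (h 1))⌉ : ℝ) ≤
      ∑ i, (x S.root i : ℝ) := mod_cast ceil_le_sum_root S hh hF
  unfold lbound
  rw [← S.sum_stageNodes, Finset.mul_sum, ← Finset.sum_attach (Finset.Icc 1 T),
    ← Finset.sum_attach (Finset.Icc 1 T) (fun s => ∑ n ∈ S.stageNodes s, _),
    ← Finset.sum_add_distrib]
  refine Finset.sum_le_sum fun ⟨s, hs⟩ _ => ?_
  obtain ⟨hs1, hsT⟩ := Finset.mem_Icc.mp hs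
  rw [← one_mul (_ + _), ← hp1 s hs1 hsT, Finset.sum_mul]
  refine Finset.sum_le_sum fun n hn => mul_le_mul_of_nonneg_left ?_ (hp n)
  refine le_trans (add_le_add ?_ ?_) (inf_mul_le_gcost S hf hF n)
  · rw [mul_comm, (Finset.mem_filter.mp hn).2]
    exact mul_le_mul_of_nonneg_left hceil (Finset.le_inf' _ _ fun i _ => hf s hs1 hsT i)
  · rw [(Finset.mem_filter.mp hn).2]
    exact mul_le_mul_of_nonneg_left (Finset.inf'_le _ hn)
      (Finset.le_inf' _ _ fun ij _ => hc s hs1 hsT ij.1 ij.2)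

end ConcreteModel

/-- key lower bound in the proof of Theorem 4: every feasible
tuple of the concrete capacity model has objective value at least
`⌈D₁/h_max⌉ ∑ₛ minᵢ f_{s,i} + ∑ₛ (min_{i,j} c_{s,ij}) min_{n∈𝒯ₛ} ∑ⱼ d_{n,j}`;
in particular, if the feasible set is nonempty then so is its infimum. -/
theorem concrete_objective_lower_bound {T M N : ℕ} [NeZero M] [NeZero N] (S : STree T)
    (p : S.Node → ℝ) (h f : ℕ → Fin M → ℝ) (c : ℕ → Fin M → Fin N → ℝ)
    (d : S.Node → Fin N → ℝ) (lam alpha : ℕ → ℝ)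
    (hp : ∀ n, 0 ≤ p n)
    (hp1 : ∀ s, 1 ≤ s → s ≤ T → ∑ n ∈ S.stageNodes s, p n = 1)
    (hpc : ∀ n, S.stage n ≠ T → ∑ m ∈ S.children n, p m = p n)
    (hh : ∀ s, 1 ≤ s → s ≤ T → ∀ i, 0 < h s i)
    (hf : ∀ s, 1 ≤ s → s ≤ T → ∀ i, 0 ≤ f s i)
    (hc : ∀ s, 1 ≤ s → s ≤ T → ∀ i j, 0 ≤ c s i j)
    (hd : ∀ n j, 0 ≤ d n j)
    (hlam : ∀ s, 2 ≤ s → s ≤ T → 0 ≤ lam s ∧ lam s ≤ 1)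
    (halpha : ∀ s, 2 ≤ s → s ≤ T → 0 ≤ alpha s ∧ alpha s < 1) :
    (∀ x y η u, CFeas S h f c d x y η u →
      lbound S h f c d ≤ CF S p f c lam alpha x y η u) ∧
    ((∃ x y η u, CFeas S h f c d x y η u) →
      lbound S h f c d ≤
        sInf {v : ℝ | ∃ x y η u, CFeas S h f c d x y η u ∧ v = CF S p f c lam alpha x y η u}) := by
  have key : ∀ x y η u, CFeas S h f c d x y η u →
      lbound S h f c d ≤ CF S p f c lam alpha x y η u := fun x y η u hF =>
    (lbound_le_sum_gcost S hp hp1 (hh 1 le_rfl S.hT) hf hc hF).trans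
      (sum_gcost_le_CF S hp hpc hlam halpha hF)
  refine ⟨key, ?_⟩
  rintro ⟨x, y, η, u, hF⟩
  refine le_csInf ⟨_, x, y, η, u, hF, rfl⟩ ?_
  rintro v ⟨x, y, η, u, hF, rfl⟩
  exact key x y η u hF
end
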